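/- arXiv:2307.03928 — 3 statements merged into one kernel-verified Lean document; each statement's English description precedes it below -/
import Mathlib

section
/- Let b > 0, Δ ≥ 0, μ₁ = Δ/b, and κ ∈ [0,1]. Then sup{Lap(Δ,b)(E) : E ⊆ ℝ measurable, Lap(0,b)(E) ≤ κ} = 1 − f_Lap(κ, μ₁), where f_Lap(α, μ₁) = 1 − α·e^{μ₁} if α < e^{−μ₁}/2, f_Lap(α, μ₁) = e^{−μ₁}/(4α) if e^{−μ₁}/2 ≤ α ≤ 1/2, and f_Lap(α, μ₁) = (1 − α)·e^{−μ₁} if α > 1/2. (The Laplace mechanism satisfies (η, γ)-ReRo with γ = 1 − f_Lap(κ(η), μ₁).) -/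
open MeasureTheory Set

/-- The Laplace measure on `ℝ` with location `m` and scale `b`. -/
noncomputable def Lap (m b : ℝ) : Measure ℝ :=
  volume.withDensity fun x => ENNReal.ofReal ((1 / (2 * b)) * Real.exp (-|x - m| / b))

/-- The closed-form trade-off function of the Laplace mechanism. -/
noncomputable def fLap (α μ₁ : ℝ) : ℝ :=
  if α < Real.exp (-μ₁) / 2 then 1 - α * Real.exp μ₁
  else if α ≤ 1 / 2 then Real.exp (-μ₁) / (4 * α)
  else (1 - α) * Real.exp (-μ₁)

noncomputable def lapD (m b : ℝ) (x : ℝ) : ℝ := (1 / (2 * b)) * Real.exp (-|x - m| / b)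

lemma lapD_nonneg (m b : ℝ) (hb : 0 < b) (x : ℝ) : 0 ≤ lapD m b x := by
  unfold lapD; positivity

lemma lapD_right (m b t : ℝ) (hb : 0 < b) (h : m ≤ t) :
    IntegrableOn (lapD m b) (Ioi t) ∧
      ∫ x in Ioi t, lapD m b x = Real.exp ((m - t) / b) / 2 := by
  have hE : EqOn (fun x => (1 / (2 * b)) * Real.exp (m / b) * Real.exp ((-1 / b) * x))
      (lapD m b) (Ioi t) := by
    intro x hx
    have hx' : t < x := hx
    simp only [lapD]
    rw [abs_of_nonneg (by linarith), mul_assoc, ← Real.exp_add]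
    congr 2; ring
  have ha : -1 / b < 0 := div_neg_of_neg_of_pos (by norm_num) hb
  refine ⟨IntegrableOn.congr_fun (Integrable.const_mul (integrableOn_exp_mul_Ioi ha t) _) hE measurableSet_Ioi, ?_⟩
  rw [← setIntegral_congr_fun measurableSet_Ioi hE, integral_const_mul,
    integral_exp_mul_Ioi ha]
  have : Real.exp ((m - t) / b) = Real.exp (m / b) * Real.exp (-1 / b * t) := by
    rw [← Real.exp_add]; congr 1; ring
  rw [this]; field_simp

lemma lapD_left (m b t : ℝ) (hb : 0 < b) (h : t ≤ m) :
    IntegrableOn (lapD m b) (Iic t) ∧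
      ∫ x in Iic t, lapD m b x = Real.exp ((t - m) / b) / 2 := by
  have hE : EqOn (fun x => (1 / (2 * b)) * Real.exp (-m / b) * Real.exp ((1 / b) * x))
      (lapD m b) (Iic t) := by
    intro x hx
    have hx' : x ≤ t := hx
    simp only [lapD]
    rw [abs_of_nonpos (by linarith), mul_assoc, ← Real.exp_add]
    congr 2; ring
  have ha : 0 < 1 / b := by positivity
  refine ⟨IntegrableOn.congr_fun (Integrable.const_mul (integrableOn_exp_mul_Iic ha t) _) hE measurableSet_Iic, ?_⟩
  rw [← setIntegral_congr_fun measurableSet_Iic hE, integral_const_mul,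
    integral_exp_mul_Iic ha]
  have : Real.exp ((t - m) / b) = Real.exp (-m / b) * Real.exp (1 / b * t) := by
    rw [← Real.exp_add]; congr 1; ring
  rw [this]; field_simp

lemma lapD_integrable (m b : ℝ) (hb : 0 < b) : Integrable (lapD m b) := by
  rw [← integrableOn_univ, ← Iic_union_Ioi (a := m)]
  exact (lapD_left m b m hb le_rfl).1.union (lapD_right m b m hb le_rfl).1

lemma lapD_split (m b t : ℝ) (hb : 0 < b) :
    (∫ x in Iic t, lapD m b x) + ∫ x in Ioi t, lapD m b x = ∫ x, lapD m b x := by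
  have := integral_add_compl (measurableSet_Iic (a := t)) (lapD_integrable m b hb)
  rwa [compl_Iic] at this

lemma lapD_total (m b : ℝ) (hb : 0 < b) : ∫ x, lapD m b x = 1 := by
  rw [← lapD_split m b m hb, (lapD_left m b m hb le_rfl).2, (lapD_right m b m hb le_rfl).2]
  simp only [sub_self, zero_div, Real.exp_zero]
  norm_num

lemma lapD_right' (m b t : ℝ) (hb : 0 < b) (h : t ≤ m) :
    ∫ x in Ioi t, lapD m b x = 1 - Real.exp ((t - m) / b) / 2 := by
  have := lapD_split m b t hb
  rw [lapD_total m b hb, (lapD_left m b t hb h).2] at this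
  linarith

lemma Lap_toReal (m b : ℝ) (hb : 0 < b) {E : Set ℝ} (hE : MeasurableSet E) :
    (Lap m b E).toReal = ∫ x in E, lapD m b x := by
  rw [Lap, withDensity_apply _ hE, integral_eq_lintegral_of_nonneg_ae
    (Filter.Eventually.of_forall (lapD_nonneg m b hb))
    (lapD_integrable m b hb).aestronglyMeasurable.restrict]
  rfl

lemma abs_mono (Δ s t : ℝ) (hΔ : 0 ≤ Δ) (h : s ≤ t) : |s| - |s - Δ| ≤ |t| - |t - Δ| := by
  rcases abs_cases s with h1 | h1 <;> rcases abs_cases (s - Δ) with h2 | h2 <;>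
  rcases abs_cases t with h3 | h3 <;> rcases abs_cases (t - Δ) with h4 | h4 <;> linarith

lemma np (b Δ t : ℝ) (hb : 0 < b) (hΔ : 0 ≤ Δ) {E : Set ℝ} (hE : MeasurableSet E)
    (hk : ∫ x in E, lapD 0 b x ≤ ∫ x in Ioi t, lapD 0 b x) :
    ∫ x in E, lapD Δ b x ≤ ∫ x in Ioi t, lapD Δ b x := by
  set c := Real.exp ((|t| - |t - Δ|) / b) with hc
  have hc0 : 0 < c := Real.exp_pos _
  have hi0 := lapD_integrable 0 b hb
  have hiΔ := lapD_integrable Δ b hb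
  have hi : Integrable (fun x => lapD Δ b x - c * lapD 0 b x) := hiΔ.sub (hi0.const_mul c)
  have hval : ∀ x, c * lapD 0 b x = (1 / (2 * b)) * Real.exp ((|t| - |t - Δ| - |x|) / b) := by
    intro x
    rw [hc, lapD, mul_left_comm, ← Real.exp_add]
    congr 2; rw [sub_zero]; ring
  have key : ∫ x in E, (lapD Δ b x - c * lapD 0 b x) ≤
      ∫ x in Ioi t, (lapD Δ b x - c * lapD 0 b x) := by
    rw [← integral_indicator hE, ← integral_indicator measurableSet_Ioi]
    refine integral_mono (hi.indicator hE) (hi.indicator measurableSet_Ioi) ?_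
    intro x
    by_cases hx : x ∈ Ioi t
    · have hx' : t < x := hx
      have hge : 0 ≤ lapD Δ b x - c * lapD 0 b x := by
        rw [hval, lapD, sub_nonneg]
        have := abs_mono Δ t x hΔ hx'.le
        gcongr
        linarith
      by_cases hxE : x ∈ E <;> simp only [indicator, hx, hxE, if_true, if_false] <;> first | exact le_rfl | exact hge
    · have hx' : x ≤ t := not_lt.mp hx
      have hge : lapD Δ b x - c * lapD 0 b x ≤ 0 := by
        rw [hval, lapD, sub_nonpos]
        have := abs_mono Δ x t hΔ hx'
        gcongr
        linarith
      by_cases hxE : x ∈ E <;> simp only [indicator, hx, hxE, if_true, if_false] <;> first | exact le_rfl | exact hge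
  rw [integral_sub hiΔ.integrableOn (hi0.const_mul c).integrableOn,
    integral_sub hiΔ.integrableOn (hi0.const_mul c).integrableOn,
    integral_const_mul, integral_const_mul] at key
  nlinarith

lemma exists_t (b Δ : ℝ) (hb : 0 < b) (hΔ : 0 ≤ Δ) (κ : ℝ) (h0 : 0 < κ) (h1 : κ < 1) :
    ∃ t, ∫ x in Ioi t, lapD 0 b x = κ ∧ ∫ x in Ioi t, lapD Δ b x = 1 - fLap κ (Δ / b) := by
  have hm : 0 ≤ Δ / b := by positivity
  have he1 : Real.exp (-(Δ / b)) ≤ 1 := Real.exp_le_one_iff.mpr (by linarith)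
  by_cases hk : κ ≤ 1 / 2
  · have hL : Real.exp (-Real.log (2 * κ)) = 1 / (2 * κ) := by
      rw [Real.exp_neg, Real.exp_log (by positivity), one_div]
    have hL' : Real.exp (Real.log (2 * κ)) = 2 * κ := Real.exp_log (by positivity)
    have hlog : Real.log (2 * κ) ≤ 0 := Real.log_nonpos (by positivity) (by linarith)
    refine ⟨-b * Real.log (2 * κ), ?_, ?_⟩
    · rw [(lapD_right 0 b _ hb (by nlinarith)).2]
      have : (0 - -b * Real.log (2 * κ)) / b = Real.log (2 * κ) := by field_simp; ring
      rw [this, hL']; ring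
    · unfold fLap
      split_ifs with hlt
      · have : Real.log (2 * κ) ≤ -(Δ / b) := by
          rw [Real.log_le_iff_le_exp (by positivity)]; linarith
        have h2 : Δ ≤ -b * Real.log (2 * κ) := by
          have := mul_le_mul_of_nonneg_left this hb.le
          have h3 : b * -(Δ / b) = -Δ := by field_simp
          linarith
        rw [(lapD_right Δ b _ hb h2).2]
        have : (Δ - -b * Real.log (2 * κ)) / b = Real.log (2 * κ) + Δ / b := by field_simp; ring
        rw [this, Real.exp_add, hL']; ring
      · have : -(Δ / b) ≤ Real.log (2 * κ) := by
          rw [Real.le_log_iff_exp_le (by positivity)]; linarith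
        have h2 : -b * Real.log (2 * κ) ≤ Δ := by
          have := mul_le_mul_of_nonneg_left this hb.le
          have h3 : b * -(Δ / b) = -Δ := by field_simp
          linarith
        rw [lapD_right' Δ b _ hb h2]
        have : (-b * Real.log (2 * κ) - Δ) / b = -Real.log (2 * κ) + -(Δ / b) := by
          field_simp; ring
        rw [this, Real.exp_add, hL]; field_simp; ring
  · push Not at hk
    have hL : Real.exp (Real.log (2 * (1 - κ))) = 2 * (1 - κ) := Real.exp_log (by linarith)
    have hlog : Real.log (2 * (1 - κ)) ≤ 0 := Real.log_nonpos (by linarith) (by linarith)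
    have ht : b * Real.log (2 * (1 - κ)) ≤ 0 := by nlinarith
    refine ⟨b * Real.log (2 * (1 - κ)), ?_, ?_⟩
    · rw [lapD_right' 0 b _ hb ht]
      have : (b * Real.log (2 * (1 - κ)) - 0) / b = Real.log (2 * (1 - κ)) := by field_simp; ring
      rw [this, hL]; ring
    · unfold fLap
      rw [if_neg (by linarith), if_neg (by linarith), lapD_right' Δ b _ hb (by linarith)]
      have : (b * Real.log (2 * (1 - κ)) - Δ) / b = Real.log (2 * (1 - κ)) + -(Δ / b) := by
        field_simp; ring
      rw [this, Real.exp_add, hL]; ring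

/-- The Laplace mechanism satisfies `(η, γ)`-ReRo with `γ = 1 - f_Lap(κ(η), μ₁)`:
the blow-up `B_κ(Lap(Δ,b), Lap(0,b)) = 1 - f_Lap(κ, Δ/b)`. -/
theorem blowup_laplace (b Δ : ℝ) (hb : 0 < b) (hΔ : 0 ≤ Δ)
    (μ₁ : ℝ) (hμ₁ : μ₁ = Δ / b) (κ : ℝ) (hκ : κ ∈ Icc (0 : ℝ) 1) :
    sSup {x : ℝ | ∃ E : Set ℝ, MeasurableSet E ∧ (Lap 0 b E).toReal ≤ κ ∧
        x = (Lap Δ b E).toReal} = 1 - fLap κ μ₁ := by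
  subst hμ₁
  have hm : 0 ≤ Δ / b := by positivity
  have he1 : Real.exp (-(Δ / b)) ≤ 1 := Real.exp_le_one_iff.mpr (by linarith)
  have he0 : 0 < Real.exp (-(Δ / b)) := Real.exp_pos _
  apply IsGreatest.csSup_eq
  rcases eq_or_lt_of_le hκ.1 with h0 | h0
  · subst h0
    have hf : fLap 0 (Δ / b) = 1 := by
      unfold fLap
      rw [if_pos (by positivity)]; ring
    rw [hf]
    refine ⟨⟨∅, MeasurableSet.empty, by simp, by simp⟩, ?_⟩
    rintro x ⟨E, hE, h1, rfl⟩
    rw [Lap_toReal _ _ hb hE] at *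
    have hz : ∀ t : ℝ, ∫ x in E, lapD 0 b x ≤ ∫ x in Ioi t, lapD 0 b x := fun t =>
      h1.trans (setIntegral_nonneg measurableSet_Ioi fun x _ => lapD_nonneg 0 b hb x)
    have hlim : Filter.Tendsto (fun t : ℝ => Real.exp ((Δ - t) / b) / 2) Filter.atTop
        (nhds (1 - 1)) := by
      have h2 : Filter.Tendsto (fun t : ℝ => (Δ - t) / b) Filter.atTop Filter.atBot := by
        apply Filter.Tendsto.atBot_div_const hb
        refine (Filter.tendsto_atBot_add_const_left Filter.atTop Δ
          Filter.tendsto_neg_atTop_atBot).congr fun t => ?_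
        exact (sub_eq_add_neg Δ t).symm
      have := (Real.tendsto_exp_atBot.comp h2).div_const 2
      simpa using this
    refine ge_of_tendsto hlim ?_
    filter_upwards [Filter.eventually_ge_atTop Δ] with t ht
    rw [← (lapD_right Δ b t hb ht).2]
    exact np b Δ t hb hΔ hE (hz t)
  rcases eq_or_lt_of_le hκ.2 with h1 | h1
  · subst h1
    have hf : fLap 1 (Δ / b) = 0 := by
      unfold fLap
      rw [if_neg (by linarith), if_neg (by norm_num)]; ring
    rw [hf]
    refine ⟨⟨univ, MeasurableSet.univ, ?_, ?_⟩, ?_⟩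
    · rw [Lap_toReal _ _ hb .univ, setIntegral_univ, lapD_total _ _ hb]
    · rw [Lap_toReal _ _ hb .univ, setIntegral_univ, lapD_total _ _ hb]; ring
    rintro x ⟨E, hE, -, rfl⟩
    rw [Lap_toReal _ _ hb hE, sub_zero, ← lapD_total Δ b hb]
    exact setIntegral_le_integral (lapD_integrable Δ b hb)
      (Filter.Eventually.of_forall (lapD_nonneg Δ b hb))
  obtain ⟨t, ht0, htΔ⟩ := exists_t b Δ hb hΔ κ h0 h1
  refine ⟨⟨Ioi t, measurableSet_Ioi, ?_, ?_⟩, ?_⟩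
  · rw [Lap_toReal _ _ hb measurableSet_Ioi, ht0]
  · rw [Lap_toReal _ _ hb measurableSet_Ioi, htΔ]
  rintro x ⟨E, hE, hk, rfl⟩
  rw [Lap_toReal _ _ hb hE] at *
  rw [← htΔ]
  exact np b Δ t hb hΔ hE (by rw [ht0]; exact hk)
end

section
/- Let σ > 0, Δ ≥ 0, μ₂ = Δ/σ, κ ∈ (0,1), and let c ∈ ℝ satisfy Φ(c) = 1 − κ, where Φ is the standard normal CDF. Then sup{N(Δ, σ²)(E) : E ⊆ ℝ measurable, N(0, σ²)(E) ≤ κ} = 1 − Φ(c − μ₂) = Φ(μ₂ − c). (The Gaussian mechanism satisfies (η, γ)-ReRo with γ = 1 − f_Gauss(κ(η), μ₂).) -/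
open MeasureTheory Set ProbabilityTheory NNReal

/-- The standard normal cumulative distribution function. -/
noncomputable def Phi (x : ℝ) : ℝ := (gaussianReal 0 1 (Iic x)).toReal

lemma aux_Iic (σ : ℝ≥0) (hσ : 0 < σ) (m t : ℝ) :
    (gaussianReal m (σ ^ 2) (Iic t)).toReal = Phi ((t - m) / σ) := by
  have hs : (0 : ℝ) < σ := by exact_mod_cast hσ
  have h : gaussianReal m (σ ^ 2) =
      ((gaussianReal 0 1).map (fun x => (σ : ℝ) * x)).map (fun x => x + m) := by
    rw [gaussianReal_map_const_mul, gaussianReal_map_add_const]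
    congr 1
    · simp
    · ext; simp
  rw [h, Measure.map_map (by fun_prop) (by fun_prop),
    Measure.map_apply (by fun_prop) measurableSet_Iic, Phi]
  congr 2
  ext x
  simp only [mem_preimage, Function.comp, mem_Iic]
  rw [le_div_iff₀ hs]
  constructor <;> intro h <;> linarith

lemma aux_Ioi (σ : ℝ≥0) (hσ : 0 < σ) (m t : ℝ) :
    (gaussianReal m (σ ^ 2) (Ioi t)).toReal = 1 - Phi ((t - m) / σ) := by
  rw [← aux_Iic σ hσ, ← compl_Iic]
  exact probReal_compl_eq_one_sub measurableSet_Iic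

lemma aux_neg (x : ℝ) : 1 - Phi x = Phi (-x) := by
  have h := aux_Ioi 1 one_pos 0 x
  simp only [one_pow, NNReal.coe_one, sub_zero, div_one] at h
  rw [← h, Phi]
  have h2 : gaussianReal 0 1 = (gaussianReal 0 1).map (fun x : ℝ => -x) := by
    rw [gaussianReal_map_neg]; simp
  haveI := nullSingletonClass_gaussianReal (μ := 0) (v := 1) one_ne_zero
  conv_rhs => rw [h2, Measure.map_apply (by fun_prop) measurableSet_Iic]
  congr 1
  have : (fun x : ℝ => -x) ⁻¹' Iic (-x) = Ici x := by ext; simp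
  rw [this]
  exact measure_congr Ioi_ae_eq_Ici

lemma aux_int (m : ℝ) (v : ℝ≥0) (hv : v ≠ 0) (E : Set ℝ) :
    (gaussianReal m v E).toReal = ∫ x in E, gaussianPDFReal m v x := by
  rw [gaussianReal_apply_eq_integral m hv, ENNReal.toReal_ofReal]
  exact integral_nonneg fun x => gaussianPDFReal_nonneg _ _ _

lemma aux_np (v : ℝ≥0) (hv : v ≠ 0) (Δ : ℝ) (hΔ : 0 ≤ Δ) (t : ℝ) (E : Set ℝ)
    (hE : MeasurableSet E)
    (h : (gaussianReal 0 v E).toReal ≤ (gaussianReal 0 v (Ioi t)).toReal) :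
    (gaussianReal Δ v E).toReal ≤ (gaussianReal Δ v (Ioi t)).toReal := by
  have hv' : (0 : ℝ) < v := by exact_mod_cast pos_iff_ne_zero.mpr hv
  set L : ℝ → ℝ := fun x => Real.exp ((2 * Δ * x - Δ ^ 2) / (2 * v)) with hL
  have hLm : Monotone L := by
    intro a b hab
    simp only [hL]
    gcongr
  have hp : ∀ x, gaussianPDFReal Δ v x = L x * gaussianPDFReal 0 v x := by
    intro x
    simp only [gaussianPDFReal, hL]
    rw [mul_left_comm, ← Real.exp_add]
    congr 2
    field_simp
    ring
  set f : ℝ → ℝ := fun x => gaussianPDFReal Δ v x - L t * gaussianPDFReal 0 v x with hf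
  have i1 := integrable_gaussianPDFReal Δ v
  have i2 := (integrable_gaussianPDFReal 0 v).const_mul (L t)
  have key : ∀ A : Set ℝ, ∫ x in A, f x =
      (gaussianReal Δ v A).toReal - L t * (gaussianReal 0 v A).toReal := by
    intro A
    rw [aux_int _ _ hv, aux_int _ _ hv, ← integral_const_mul]
    exact integral_sub i1.integrableOn i2.integrableOn
  have fi : Integrable f := i1.sub i2
  have hfx : ∀ x, f x = (L x - L t) * gaussianPDFReal 0 v x := by
    intro x; simp only [hf]; rw [hp]; ring
  have le : ∫ x in E, f x ≤ ∫ x in Ioi t, f x := by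
    rw [← integral_indicator hE, ← integral_indicator measurableSet_Ioi]
    refine integral_mono (fi.indicator hE) (fi.indicator measurableSet_Ioi) fun x => ?_
    have h0 := gaussianPDFReal_nonneg 0 v x
    by_cases hx : x ∈ Ioi t
    · have : 0 ≤ f x := by
        rw [hfx]; exact mul_nonneg (sub_nonneg.2 (hLm (le_of_lt hx))) h0
      by_cases hxE : x ∈ E <;> simp [indicator, hx, hxE, this]
    · have : f x ≤ 0 := by
        rw [hfx]
        exact mul_nonpos_of_nonpos_of_nonneg (sub_nonpos.2 (hLm (not_lt.1 hx))) h0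
      rw [indicator_of_notMem hx]
      by_cases hxE : x ∈ E
      · rwa [indicator_of_mem hxE]
      · rw [indicator_of_notMem hxE]
  rw [key, key] at le
  have := mul_le_mul_of_nonneg_left h (Real.exp_pos ((2 * Δ * t - Δ ^ 2) / (2 * v))).le
  change L t * _ ≤ L t * _ at this
  linarith

/-- The Gaussian mechanism satisfies `(η, γ)`-ReRo with `γ = 1 - f_Gauss(κ(η), μ₂)`:
the blow-up `B_κ(N(Δ,σ²), N(0,σ²)) = 1 - Φ(c - μ₂) = Φ(μ₂ - c)`, where `Φ(c) = 1 - κ`. -/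
theorem blowup_gaussian (σ : ℝ≥0) (hσ : 0 < σ) (Δ : ℝ) (hΔ : 0 ≤ Δ)
    (μ₂ : ℝ) (hμ₂ : μ₂ = Δ / (σ : ℝ))
    (κ : ℝ) (hκ : κ ∈ Ioo (0 : ℝ) 1) (c : ℝ) (hc : Phi c = 1 - κ) :
    sSup {x : ℝ | ∃ E : Set ℝ, MeasurableSet E ∧
        (gaussianReal 0 (σ ^ 2) E).toReal ≤ κ ∧
        x = (gaussianReal Δ (σ ^ 2) E).toReal} = 1 - Phi (c - μ₂) ∧
      1 - Phi (c - μ₂) = Phi (μ₂ - c) := by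
  have hs : (σ : ℝ) ≠ 0 := by exact_mod_cast hσ.ne'
  refine ⟨?_, by rw [aux_neg, neg_sub]⟩
  have h0 : (gaussianReal 0 (σ ^ 2) (Ioi (σ * c))).toReal = κ := by
    rw [aux_Ioi σ hσ, sub_zero, mul_div_cancel_left₀ _ hs, hc]; ring
  have h1 : (gaussianReal Δ (σ ^ 2) (Ioi (σ * c))).toReal = 1 - Phi (c - μ₂) := by
    rw [aux_Ioi σ hσ, _root_.sub_div, mul_div_cancel_left₀ _ hs, hμ₂]
  refine IsGreatest.csSup_eq ⟨⟨Ioi (σ * c), measurableSet_Ioi, h0.le, h1.symm⟩, ?_⟩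
  rintro x ⟨E, hE, hEκ, rfl⟩
  rw [← h1]
  exact aux_np _ (pow_ne_zero _ hσ.ne') Δ hΔ _ E hE (hEκ.trans h0.ge)
end

section
/- Let b > 0, Δ ≥ 0, μ₁ = Δ/b, p ∈ [0,1], and α ∈ [0,1]. Let P = Lap(0, b) and let Q_p = (1 − p)·Lap(0, b) + p·Lap(Δ, b) be the corresponding mixture measure on ℝ. Then inf{Q_p(Eᶜ) : E ⊆ ℝ measurable, P(E) ≤ α} = (1 − p)(1 − α) + p·f_Lap(α, μ₁), where f_Lap(α, μ₁) = 1 − α·e^{μ₁} if α < e^{−μ₁}/2, f_Lap(α, μ₁) = e^{−μ₁}/(4α) if e^{−μ₁}/2 ≤ α ≤ 1/2, and f_Lap(α, μ₁) = (1 − α)·e^{−μ₁} if α > 1/2. (Single-step trade-off function of the Poisson-subsampled Laplace mechanism for the add-one dominating pair.) -/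
open MeasureTheory Set

lemma lap_Ioi (m b t : ℝ) (hb : 0 < b) (h : m ≤ t) :
    Lap m b (Ioi t) = ENNReal.ofReal (Real.exp (-(t - m) / b) / 2) := by
  have hb' : -(1 / b) < 0 := by simpa using hb
  have hc : EqOn (fun x => (1 / (2 * b)) * Real.exp (-|x - m| / b))
      (fun x => (1 / (2 * b)) * Real.exp (m / b) * Real.exp (-(1 / b) * x)) (Ioi t) := by
    intro x hx
    have hx' : t < x := hx
    simp only
    rw [abs_of_nonneg (by linarith), mul_assoc, ← Real.exp_add]
    congr 2
    field_simp
    ring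
  have hi : IntegrableOn (fun x => (1 / (2 * b)) * Real.exp (-|x - m| / b)) (Ioi t) := by
    rw [integrableOn_congr_fun hc measurableSet_Ioi]
    exact (integrableOn_exp_mul_Ioi hb' t).const_mul _
  rw [Lap, withDensity_apply _ measurableSet_Ioi,
    ← ofReal_integral_eq_lintegral_ofReal hi (ae_of_all _ fun x => by positivity),
    setIntegral_congr_fun measurableSet_Ioi hc, integral_const_mul, integral_exp_mul_Ioi hb']
  congr 1
  have : Real.exp (-(t - m) / b) = Real.exp (m / b) * Real.exp (-(1 / b) * t) := by
    rw [← Real.exp_add]; congr 1; field_simp; ring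
  rw [this]
  field_simp

lemma lap_Iic (m b t : ℝ) (hb : 0 < b) (h : t ≤ m) :
    Lap m b (Iic t) = ENNReal.ofReal (Real.exp ((t - m) / b) / 2) := by
  have hb' : 0 < 1 / b := by positivity
  have hc : EqOn (fun x => (1 / (2 * b)) * Real.exp (-|x - m| / b))
      (fun x => (1 / (2 * b)) * Real.exp (-m / b) * Real.exp ((1 / b) * x)) (Iic t) := by
    intro x hx
    have hx' : x ≤ t := hx
    simp only
    rw [abs_of_nonpos (by linarith), mul_assoc, ← Real.exp_add]
    congr 2
    field_simp
    ring
  have hi : IntegrableOn (fun x => (1 / (2 * b)) * Real.exp (-|x - m| / b)) (Iic t) := by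
    rw [integrableOn_congr_fun hc measurableSet_Iic]
    exact (integrableOn_exp_mul_Iic hb' t).const_mul _
  rw [Lap, withDensity_apply _ measurableSet_Iic,
    ← ofReal_integral_eq_lintegral_ofReal hi (ae_of_all _ fun x => by positivity),
    setIntegral_congr_fun measurableSet_Iic hc, integral_const_mul, integral_exp_mul_Iic hb']
  congr 1
  have : Real.exp ((t - m) / b) = Real.exp (-m / b) * Real.exp ((1 / b) * t) := by
    rw [← Real.exp_add]; congr 1; field_simp; ring
  rw [this]
  field_simp

lemma lap_prob (m b : ℝ) (hb : 0 < b) : IsProbabilityMeasure (Lap m b) := by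
  constructor
  rw [← Iic_union_Ioi (a := m), measure_union (Set.Iic_disjoint_Ioi le_rfl) measurableSet_Ioi,
    lap_Ioi m b m hb le_rfl, lap_Iic m b m hb le_rfl, ← ENNReal.ofReal_add] <;> norm_num

lemma lap_real_Ioi (m b t : ℝ) (hb : 0 < b) (h : m ≤ t) :
    (Lap m b).real (Ioi t) = Real.exp (-(t - m) / b) / 2 := by
  rw [Measure.real, lap_Ioi m b t hb h, ENNReal.toReal_ofReal (by positivity)]

lemma lap_real_Ioi' (m b t : ℝ) (hb : 0 < b) (h : t ≤ m) :
    (Lap m b).real (Ioi t) = 1 - Real.exp ((t - m) / b) / 2 := by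
  have := lap_prob m b hb
  rw [← compl_Iic, probReal_compl_eq_one_sub measurableSet_Iic,
    Measure.real, lap_Iic m b t hb h, ENNReal.toReal_ofReal (by positivity)]

lemma lap_ratio (m m' b u : ℝ) (hb : 0 < b) (S : Set ℝ) (hS : MeasurableSet S)
    (h : ∀ x ∈ S, |x - m'| - |x - m| ≤ u * b) :
    (Lap m b).real S ≤ Real.exp u * (Lap m' b).real S := by
  have := lap_prob m b hb
  have := lap_prob m' b hb
  have key : Lap m b S ≤ ENNReal.ofReal (Real.exp u) * Lap m' b S := by
    rw [Lap, Lap, withDensity_apply _ hS, withDensity_apply _ hS,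
      ← lintegral_const_mul _ (by fun_prop)]
    refine setLIntegral_mono (by fun_prop) fun x hx => ?_
    rw [← ENNReal.ofReal_mul (by positivity)]
    apply ENNReal.ofReal_le_ofReal
    rw [mul_left_comm, ← Real.exp_add]
    gcongr
    rw [div_le_iff₀ hb, add_mul, div_mul_cancel₀ _ hb.ne']
    linarith [h x hx]
  have := ENNReal.toReal_mono (by finiteness) key
  rwa [ENNReal.toReal_mul, ENNReal.toReal_ofReal (by positivity)] at this

lemma lap_NP (b Δ t : ℝ) (hb : 0 < b) (h0 : 0 ≤ t) (h1 : t ≤ Δ) (E : Set ℝ)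
    (hE : MeasurableSet E) (hPE : (Lap 0 b).real E ≤ (Lap 0 b).real (Ioi t)) :
    (Lap Δ b).real E ≤ (Lap Δ b).real (Ioi t) := by
  have := lap_prob 0 b hb
  have := lap_prob Δ b hb
  have hT : MeasurableSet (Ioi t) := measurableSet_Ioi
  have a1 := lap_ratio Δ 0 b ((2 * t - Δ) / b) hb (E \ Ioi t) (hE.diff hT) (by
    intro x hx
    have hx' : x ≤ t := not_lt.1 hx.2
    rw [div_mul_cancel₀ _ hb.ne']
    rcases abs_cases (x - 0) with h | h <;> rcases abs_cases (x - Δ) with h' | h' <;> linarith)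
  have a2 := lap_ratio 0 Δ b (-((2 * t - Δ) / b)) hb (Ioi t \ E) (hT.diff hE) (by
    intro x hx
    have hx' : t < x := hx.1
    rw [neg_mul, div_mul_cancel₀ _ hb.ne']
    rcases abs_cases (x - 0) with h | h <;> rcases abs_cases (x - Δ) with h' | h' <;> linarith)
  rw [Real.exp_neg, inv_mul_eq_div, le_div_iff₀ (Real.exp_pos _)] at a2
  have e1 := measureReal_inter_add_sdiff (μ := Lap 0 b) (s := E) hT
  have e2 := measureReal_inter_add_sdiff (μ := Lap 0 b) (s := Ioi t) hE
  have e3 := measureReal_inter_add_sdiff (μ := Lap Δ b) (s := E) hT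
  have e4 := measureReal_inter_add_sdiff (μ := Lap Δ b) (s := Ioi t) hE
  rw [inter_comm] at e2 e4
  have : (Lap 0 b).real (E \ Ioi t) ≤ (Lap 0 b).real (Ioi t \ E) := by linarith
  have := mul_le_mul_of_nonneg_left this (Real.exp_pos ((2 * t - Δ) / b)).le
  linarith

lemma lap_lower (b Δ : ℝ) (hb : 0 < b) (hΔ : 0 ≤ Δ) (α : ℝ) (E : Set ℝ)
    (hE : MeasurableSet E) (hPE : (Lap 0 b).real E ≤ α) :
    fLap α (Δ / b) ≤ 1 - (Lap Δ b).real E := by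
  have := lap_prob 0 b hb
  have := lap_prob Δ b hb
  unfold fLap
  split_ifs with h1 h2
  · have := lap_ratio Δ 0 b (Δ / b) hb E hE (by
      intro x _
      rw [div_mul_cancel₀ _ hb.ne']
      rcases abs_cases (x - 0) with h | h <;> rcases abs_cases (x - Δ) with h' | h' <;> linarith)
    have := mul_le_mul_of_nonneg_left hPE (Real.exp_pos (Δ / b)).le
    linarith
  · push Not at h1
    have hα : 0 < α := lt_of_lt_of_le (by positivity) h1
    have ht0 : 0 ≤ -(b * Real.log (2 * α)) := by
      have := Real.log_nonpos (by positivity) (show 2 * α ≤ 1 by linarith)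
      nlinarith
    have ht1 : -(b * Real.log (2 * α)) ≤ Δ := by
      have : -(Δ / b) ≤ Real.log (2 * α) := by
        rw [Real.le_log_iff_exp_le (by positivity)]; linarith
      rw [← neg_div, div_le_iff₀ hb] at this
      linarith
    have hl : -(-(b * Real.log (2 * α)) - 0) / b = Real.log (2 * α) := by
      field_simp; ring
    have hr : (-(b * Real.log (2 * α)) - Δ) / b = -(Δ / b) - Real.log (2 * α) := by
      field_simp; ring
    have hP := lap_real_Ioi 0 b _ hb ht0
    rw [hl, Real.exp_log (by positivity)] at hP
    have hL := lap_real_Ioi' Δ b _ hb ht1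
    rw [hr, Real.exp_sub, Real.exp_log (by positivity)] at hL
    have := lap_NP b Δ _ hb ht0 ht1 E hE (by rw [hP]; linarith)
    rw [hL] at this
    have h4 : Real.exp (-(Δ / b)) / (4 * α) = Real.exp (-(Δ / b)) / (2 * α) / 2 := by
      field_simp; norm_num
    linarith
  · have := lap_ratio 0 Δ b (Δ / b) hb Eᶜ hE.compl (by
      intro x _
      rw [div_mul_cancel₀ _ hb.ne']
      rcases abs_cases (x - 0) with h | h <;> rcases abs_cases (x - Δ) with h' | h' <;> linarith)
    rw [probReal_compl_eq_one_sub hE, probReal_compl_eq_one_sub hE] at this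
    rw [Real.exp_neg, ← div_eq_mul_inv, div_le_iff₀ (Real.exp_pos _)]
    linarith

lemma lap_attain (b Δ : ℝ) (hb : 0 < b) (hΔ : 0 ≤ Δ) (α : ℝ) (hα : α ∈ Icc (0 : ℝ) 1) :
    ∃ E, MeasurableSet E ∧ (Lap 0 b).real E = α ∧ fLap α (Δ / b) = 1 - (Lap Δ b).real E := by
  have := lap_prob 0 b hb
  have := lap_prob Δ b hb
  rcases hα.1.eq_or_lt with h0 | h0
  · refine ⟨∅, MeasurableSet.empty, by simp [h0], ?_⟩
    subst h0
    simp [fLap, Real.exp_pos]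
  rcases hα.2.eq_or_lt with h1 | h1
  · refine ⟨univ, MeasurableSet.univ, by simp [h1], ?_⟩
    subst h1
    have : Real.exp (-(Δ / b)) ≤ 1 := Real.exp_le_one_iff.2 (by have := div_nonneg hΔ hb.le; linarith)
    rw [fLap, if_neg (by linarith), if_neg (by norm_num)]
    simp
  rcases le_or_gt α (1 / 2) with h2 | h2
  · have ht0 : 0 ≤ -(b * Real.log (2 * α)) := by
      have := Real.log_nonpos (by positivity) (show 2 * α ≤ 1 by linarith)
      nlinarith
    have hl : -(-(b * Real.log (2 * α)) - 0) / b = Real.log (2 * α) := by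
      field_simp; ring
    have hP := lap_real_Ioi 0 b _ hb ht0
    rw [hl, Real.exp_log (by positivity)] at hP
    refine ⟨_, measurableSet_Ioi, by rw [hP]; ring, ?_⟩
    unfold fLap
    split_ifs with h3
    · have ht1 : Δ ≤ -(b * Real.log (2 * α)) := by
        have : Real.log (2 * α) ≤ -(Δ / b) := by
          rw [Real.log_le_iff_le_exp (by positivity)]; linarith
        rw [← neg_div, le_div_iff₀ hb] at this
        linarith
      have hr : -(-(b * Real.log (2 * α)) - Δ) / b = (Δ / b) + Real.log (2 * α) := by
        field_simp; ring
      rw [lap_real_Ioi Δ b _ hb ht1, hr, Real.exp_add, Real.exp_log (by positivity)]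
      ring
    · push Not at h3
      have ht1 : -(b * Real.log (2 * α)) ≤ Δ := by
        have : -(Δ / b) ≤ Real.log (2 * α) := by
          rw [Real.le_log_iff_exp_le (by positivity)]; linarith
        rw [← neg_div, div_le_iff₀ hb] at this
        linarith
      have hr : (-(b * Real.log (2 * α)) - Δ) / b = -(Δ / b) - Real.log (2 * α) := by
        field_simp; ring
      rw [lap_real_Ioi' Δ b _ hb ht1, hr, Real.exp_sub, Real.exp_log (by positivity)]
      field_simp; ring
  · have hpos : 0 < 2 * (1 - α) := by linarith
    have ht0 : b * Real.log (2 * (1 - α)) ≤ 0 := by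
      have := Real.log_nonpos hpos.le (show 2 * (1 - α) ≤ 1 by linarith)
      nlinarith
    refine ⟨Ioi (b * Real.log (2 * (1 - α))), measurableSet_Ioi, ?_, ?_⟩
    · rw [lap_real_Ioi' 0 b _ hb ht0, sub_zero, mul_div_cancel_left₀ _ hb.ne', Real.exp_log hpos]
      ring
    · have : Real.exp (-(Δ / b)) ≤ 1 :=
        Real.exp_le_one_iff.2 (by have := div_nonneg hΔ hb.le; linarith)
      rw [fLap, if_neg (by linarith), if_neg (by linarith),
        lap_real_Ioi' Δ b _ hb (ht0.trans hΔ), sub_div, mul_div_cancel_left₀ _ hb.ne', sub_eq_add_neg _ (Δ / b),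
        Real.exp_add, Real.exp_log hpos]
      ring

/-- Single-step trade-off function of the Poisson-subsampled Laplace mechanism
for the add-one dominating pair `(Lap(0,b), (1-p)Lap(0,b) + pLap(Δ,b))`:
`T(P, Q_p)(α) = (1-p)(1-α) + p·f_Lap(α, μ₁)`. -/
theorem tradeOff_subsampled_laplace (b Δ : ℝ) (hb : 0 < b) (hΔ : 0 ≤ Δ)
    (μ₁ : ℝ) (hμ₁ : μ₁ = Δ / b) (p : ℝ) (hp : p ∈ Icc (0 : ℝ) 1)
    (α : ℝ) (hα : α ∈ Icc (0 : ℝ) 1)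
    (P Q : Measure ℝ)
    (hP : P = Lap 0 b)
    (hQ : Q = ENNReal.ofReal (1 - p) • Lap 0 b + ENNReal.ofReal p • Lap Δ b) :
    sInf {x : ℝ | ∃ E : Set ℝ, MeasurableSet E ∧ (P E).toReal ≤ α ∧
        x = (Q Eᶜ).toReal} = (1 - p) * (1 - α) + p * fLap α μ₁ := by
  subst hμ₁ hP
  have := lap_prob 0 b hb
  have := lap_prob Δ b hb
  obtain ⟨hp0, hp1⟩ := hp
  have hQE : ∀ E, MeasurableSet E → (Q Eᶜ).toReal =
      (1 - p) * (1 - (Lap 0 b).real E) + p * (1 - (Lap Δ b).real E) := by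
    intro E hE
    rw [← probReal_compl_eq_one_sub hE, ← probReal_compl_eq_one_sub hE, hQ]
    simp only [Measure.add_apply, Measure.smul_apply, smul_eq_mul]
    rw [ENNReal.toReal_add (by finiteness) (by finiteness), ENNReal.toReal_mul,
      ENNReal.toReal_mul, ENNReal.toReal_ofReal (by linarith), ENNReal.toReal_ofReal hp0]
    rfl
  apply IsLeast.csInf_eq
  constructor
  · obtain ⟨E, hE, h1, h2⟩ := lap_attain b Δ hb hΔ α hα
    exact ⟨E, hE, h1.le, by rw [hQE E hE, h1, h2]⟩
  · rintro x ⟨E, hE, h1, rfl⟩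
    rw [hQE E hE]
    have h2 := lap_lower b Δ hb hΔ α E hE h1
    have h1' : (Lap 0 b).real E ≤ α := h1
    have : 0 ≤ 1 - p := by linarith
    gcongr
end
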